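/- arXiv:1910.14140 — 4 statements merged into one kernel-verified Lean document; each statement's English description precedes it below -/
import Mathlib

section
/- Let I, J ⊆ S be monomial ideals and γ ∈ ℤ^n. Then Δ_γ(I + J) = Δ_γ(I) ∩ Δ_γ(J); that is, for every F ⊆ {1,…,n}∖G_γ, x^γ ∉ (I + J) S_{F ∪ G_γ} if and only if x^γ ∉ I S_{F ∪ G_γ} and x^γ ∉ J S_{F ∪ G_γ}. -/
open MvPolynomial

noncomputable section

variable (k : Type*) [Field k]

/-- The multiplicative submonoid of `S = k[x_i : i ∈ σ]` generated by the variables `x_i, i ∈ F`. -/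
def varSubmonoid (σ : Type*) (F : Set σ) : Submonoid (MvPolynomial σ k) :=
  Submonoid.closure ((fun i => (X i : MvPolynomial σ k)) '' F)

/-- The localization `S_F` of `S` at the variables indexed by `F`. -/
abbrev Loc (σ : Type*) (F : Set σ) : Type _ := Localization (varSubmonoid k σ F)

/-- The ideal `I S_F` of `S_F` generated by the image of `I`. -/
def locIdeal {σ : Type*} (I : Ideal (MvPolynomial σ k)) (F : Set σ) : Ideal (Loc k σ F) :=
  Ideal.map (algebraMap (MvPolynomial σ k) (Loc k σ F)) I

/-- `G_γ = {i | γ i < 0}`. -/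
def negSupp {σ : Type*} (γ : σ → ℤ) : Set σ := {i | γ i < 0}

/-- The element `x^γ` of `S_F` (meaningful when `G_γ ⊆ F`):  the image of the monomial with
exponents `max (γ i) 0` multiplied by the inverse of the image of `∏ x_i ^ (-γ i)` over `G_γ`. -/
def xpow {σ : Type*} [Fintype σ] (F : Set σ) (γ : σ → ℤ) : Loc k σ F :=
  algebraMap (MvPolynomial σ k) (Loc k σ F) (∏ i, X i ^ (γ i).toNat) *
    Ring.inverse (algebraMap (MvPolynomial σ k) (Loc k σ F) (∏ i, X i ^ (-γ i).toNat))

/-- The degree complex `Δ_γ(I)`: all `F ⊆ σ \ G_γ` with `x^γ ∉ I S_{F ∪ G_γ}`. -/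
def degCx {σ : Type*} [Fintype σ] (I : Ideal (MvPolynomial σ k)) (γ : σ → ℤ) : Set (Set σ) :=
  {F | F ⊆ (negSupp γ)ᶜ ∧ xpow k (F ∪ negSupp γ) γ ∉ locIdeal k I (F ∪ negSupp γ)}

/-- A monomial ideal is an ideal generated by monomials. -/
def IsMonomialIdeal {σ : Type*} (I : Ideal (MvPolynomial σ k)) : Prop :=
  ∃ G : Set (σ →₀ ℕ),
    I = Ideal.span ((fun d => (monomial d (1 : k) : MvPolynomial σ k)) '' G)

/-- Every element of the submonoid generated by variables is a monomial. -/
theorem exists_monomial_of_mem_varSubmonoid {σ : Type*} {F : Set σ} {s : MvPolynomial σ k}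
    (hs : s ∈ varSubmonoid k σ F) : ∃ d : σ →₀ ℕ, s = monomial d (1 : k) := by
  induction hs using Submonoid.closure_induction with
  | mem x hx =>
    obtain ⟨i, -, rfl⟩ := hx
    exact ⟨Finsupp.single i 1, rfl⟩
  | one => exact ⟨0, rfl⟩
  | mul x y _ _ hx hy =>
    obtain ⟨d, rfl⟩ := hx
    obtain ⟨e, rfl⟩ := hy
    exact ⟨d + e, by simp [monomial_mul]⟩

/-- A product of powers of variables is a monomial. -/
theorem exists_prod_X_pow_eq_monomial {σ : Type*} [Fintype σ] (e : σ → ℕ) :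
    ∃ d : σ →₀ ℕ, (∏ i, X i ^ e i : MvPolynomial σ k) = monomial d (1 : k) :=
  ⟨∑ i, Finsupp.single i (e i), by simp only [X_pow_eq_monomial, monomial_sum_one]⟩

/-- A monomial lies in a sum of monomial ideals iff it lies in one of them. -/
theorem monomial_mem_add_iff {σ : Type*} {I J : Ideal (MvPolynomial σ k)}
    (hI : IsMonomialIdeal k I) (hJ : IsMonomialIdeal k J) (d : σ →₀ ℕ) :
    monomial d (1 : k) ∈ I + J ↔ monomial d (1 : k) ∈ I ∨ monomial d (1 : k) ∈ J := by
  classical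
  obtain ⟨G, rfl⟩ := hI
  obtain ⟨H, rfl⟩ := hJ
  rw [Submodule.add_eq_sup, ← Ideal.span_union, ← Set.image_union]
  simp only [mem_ideal_span_monomial_image, support_monomial, one_ne_zero, if_false,
    Finset.mem_singleton, forall_eq, Set.mem_union, or_and_right, exists_or]

/-- If `G_γ ⊆ F`, then `x^γ ∈ I S_F` iff some monomial supported on `F` multiplies the numerator
of `x^γ` into `I`. -/
theorem xpow_mem_locIdeal_iff {σ : Type*} [Fintype σ] (I : Ideal (MvPolynomial σ k))
    {F : Set σ} {γ : σ → ℤ} (hF : negSupp γ ⊆ F) :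
    xpow k F γ ∈ locIdeal k I F ↔
      ∃ s ∈ varSubmonoid k σ F, s * ∏ i, X i ^ (γ i).toNat ∈ I := by
  have hden : (∏ i, X i ^ (-γ i).toNat : MvPolynomial σ k) ∈ varSubmonoid k σ F := by
    refine Submonoid.prod_mem _ fun i _ => ?_
    by_cases hi : γ i < 0
    · exact Submonoid.pow_mem _ (Submonoid.subset_closure (Set.mem_image_of_mem _ (hF hi))) _
    · rw [Int.toNat_of_nonpos (by omega), pow_zero]
      exact Submonoid.one_mem _
  have hunit := IsLocalization.map_units (M := varSubmonoid k σ F) (Loc k σ F) ⟨_, hden⟩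
  rw [xpow, locIdeal, Ideal.mul_unit_mem_iff_mem _ hunit.ringInverse,
    IsLocalization.algebraMap_mem_map_algebraMap_iff (varSubmonoid k σ F)]

/-- For monomial ideals, `x^γ ∈ (I + J) S_F` iff `x^γ ∈ I S_F` or `x^γ ∈ J S_F`. -/
theorem xpow_mem_locIdeal_add_iff {σ : Type*} [Fintype σ] {I J : Ideal (MvPolynomial σ k)}
    (hI : IsMonomialIdeal k I) (hJ : IsMonomialIdeal k J) {F : Set σ} {γ : σ → ℤ}
    (hF : negSupp γ ⊆ F) :
    xpow k F γ ∈ locIdeal k (I + J) F ↔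
      xpow k F γ ∈ locIdeal k I F ∨ xpow k F γ ∈ locIdeal k J F := by
  simp only [xpow_mem_locIdeal_iff k _ hF, ← exists_or, ← and_or_left]
  refine exists_congr fun s => and_congr_right fun hs => ?_
  obtain ⟨d, rfl⟩ := exists_monomial_of_mem_varSubmonoid k hs
  obtain ⟨e, he⟩ := exists_prod_X_pow_eq_monomial k fun i => (γ i).toNat
  rw [he, monomial_mul, one_mul]
  exact monomial_mem_add_iff k hI hJ _

/-- for monomial ideals `I, J ⊆ S` and `γ ∈ ℤ^n`,
`Δ_γ(I + J) = Δ_γ(I) ∩ Δ_γ(J)`; that is, for every `F ⊆ {1,…,n} \ G_γ`,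
`x^γ ∉ (I+J) S_{F∪G_γ}` iff `x^γ ∉ I S_{F∪G_γ}` and `x^γ ∉ J S_{F∪G_γ}`. -/
theorem statement4 {n : ℕ} (I J : Ideal (MvPolynomial (Fin n) k))
    (hI : IsMonomialIdeal k I) (hJ : IsMonomialIdeal k J) (γ : Fin n → ℤ) :
    degCx k (I + J) γ = degCx k I γ ∩ degCx k J γ ∧
      ∀ F : Set (Fin n), F ⊆ (negSupp γ)ᶜ →
        (xpow k (F ∪ negSupp γ) γ ∉ locIdeal k (I + J) (F ∪ negSupp γ) ↔
          xpow k (F ∪ negSupp γ) γ ∉ locIdeal k I (F ∪ negSupp γ) ∧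
            xpow k (F ∪ negSupp γ) γ ∉ locIdeal k J (F ∪ negSupp γ)) := by
  have key (F : Set (Fin n)) :
      xpow k (F ∪ negSupp γ) γ ∉ locIdeal k (I + J) (F ∪ negSupp γ) ↔
        xpow k (F ∪ negSupp γ) γ ∉ locIdeal k I (F ∪ negSupp γ) ∧
          xpow k (F ∪ negSupp γ) γ ∉ locIdeal k J (F ∪ negSupp γ) := by
    rw [xpow_mem_locIdeal_add_iff k hI hJ Set.subset_union_right, not_or]
  refine ⟨Set.ext fun F => ?_, fun F _ => key F⟩
  simp only [degCx, Set.mem_inter_iff, Set.mem_ofPred_eq, key F]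
  tauto
end
end

section
/- Let I ⊆ S be a monomial ideal, let T ⊆ {1,…,n} be a set containing the support of I, and let γ ∈ ℤ^n. Let γ' ∈ ℤ^n be defined by γ'_i = γ_i for i ∈ T and γ'_i = 0 for i ∉ T. Then for every F ⊆ {1,…,n}∖G_γ, one has x^γ ∉ I S_{F ∪ G_γ} if and only if x^{γ'} ∉ I S_{(F ∩ T) ∪ G_{γ'}}. In other words, Δ_γ(I) is the join of Δ_{γ'}(I) (supported on T) with the full simplex on {1,…,n}∖(T ∪ G_γ). -/
open MvPolynomial

noncomputable section

variable (k : Type*) [Field k]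

variable {k} in
/-- The elements of `varSubmonoid k σ F` are the monic monomials with exponents supported in `F`. -/
theorem mem_varSubmonoid_iff {σ : Type*} {F : Set σ} {m : MvPolynomial σ k} :
    m ∈ varSubmonoid k σ F ↔ ∃ e : σ →₀ ℕ, (∀ i ∉ F, e i = 0) ∧ m = monomial e 1 := by
  constructor
  · intro hm
    induction hm using Submonoid.closure_induction with
    | mem x hx =>
      obtain ⟨i, hi, rfl⟩ := hx
      exact ⟨Finsupp.single i 1,
        fun j hj => Finsupp.single_eq_of_ne fun h => hj (h ▸ hi), rfl⟩
    | one => exact ⟨0, fun _ _ => rfl, rfl⟩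
    | mul x y _ _ hx hy =>
      obtain ⟨a, ha, rfl⟩ := hx
      obtain ⟨b, hb, rfl⟩ := hy
      exact ⟨a + b, fun i hi => by simp [ha i hi, hb i hi], by simp [monomial_mul]⟩
  · rintro ⟨e, he, rfl⟩
    rw [monomial_eq, C_1, one_mul]
    refine Submonoid.prod_mem _ fun i hi => Submonoid.pow_mem _ (Submonoid.subset_closure ?_) _
    refine ⟨i, ?_, rfl⟩
    by_contra h
    exact Finsupp.mem_support_iff.mp hi (he i h)

theorem prod_X_pow_eq_monomial_equivFunOnFinite {σ : Type*} [Fintype σ] (e : σ → ℕ) :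
    (∏ i, X i ^ e i : MvPolynomial σ k) = monomial (Finsupp.equivFunOnFinite.symm e) 1 := by
  rw [monomial_eq, C_1, one_mul, Finsupp.prod_fintype _ _ fun _ => pow_zero _]
  simp

/-- Membership of `x^γ` in the localization `I S_F` of a monomial ideal, in terms of exponents. -/
theorem xpow_mem_locIdeal_span_iff {σ : Type*} [Fintype σ] (G : Set (σ →₀ ℕ)) (F : Set σ)
    (γ : σ → ℤ) (hγ : negSupp γ ⊆ F) :
    xpow k F γ ∈ locIdeal k
        (Ideal.span ((fun d => (monomial d (1 : k) : MvPolynomial σ k)) '' G)) F ↔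
      ∃ d ∈ G, ∀ i ∉ F, (d i : ℤ) ≤ γ i := by
  classical
  have hunit : IsUnit (Ring.inverse (algebraMap (MvPolynomial σ k) (Loc k σ F)
      (∏ i, X i ^ (-γ i).toNat))) := by
    rw [isUnit_ringInverse, prod_X_pow_eq_monomial_equivFunOnFinite]
    refine IsLocalization.map_units (M := varSubmonoid k σ F) _
      ⟨_, mem_varSubmonoid_iff.mpr ⟨_, fun i hi => ?_, rfl⟩⟩
    have : ¬ γ i < 0 := fun h => hi (hγ h)
    simp only [Finsupp.equivFunOnFinite_symm_apply_apply]
    omega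
  rw [xpow, locIdeal, Ideal.mul_unit_mem_iff_mem _ hunit,
    IsLocalization.algebraMap_mem_map_algebraMap_iff (varSubmonoid k σ F),
    prod_X_pow_eq_monomial_equivFunOnFinite]
  constructor
  · rintro ⟨m, hm, hmI⟩
    obtain ⟨e, he, rfl⟩ := mem_varSubmonoid_iff.mp hm
    rw [monomial_mul, one_mul, mem_ideal_span_monomial_image] at hmI
    obtain ⟨d, hd, hle⟩ := hmI (e + Finsupp.equivFunOnFinite.symm fun i => (γ i).toNat)
      (by simp [support_monomial])
    refine ⟨d, hd, fun i hi => ?_⟩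
    have h := hle i
    have : ¬ γ i < 0 := fun h => hi (hγ h)
    simp only [Finsupp.add_apply, he i hi, Finsupp.equivFunOnFinite_symm_apply_apply] at h
    omega
  · rintro ⟨d, hd, hle⟩
    refine ⟨_, mem_varSubmonoid_iff.mpr
      ⟨d.filter (· ∈ F), fun i hi => Finsupp.filter_apply_neg _ _ hi, rfl⟩, ?_⟩
    rw [monomial_mul, one_mul, mem_ideal_span_monomial_image]
    intro x hx
    obtain rfl := Finset.mem_singleton.mp (support_monomial_subset hx)
    refine ⟨d, hd, fun i => ?_⟩
    by_cases hi : i ∈ F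
    · simp [hi]
    · have := hle i hi
      simp only [Finsupp.add_apply, Finsupp.filter_apply_neg (· ∈ F) d hi,
        Finsupp.equivFunOnFinite_symm_apply_apply]
      omega

/-- for a monomial ideal `I` whose generators are all supported in `T`,
`γ ∈ ℤ^n`, and `γ'` agreeing with `γ` on `T` and vanishing off `T`, one has, for every
`F ⊆ {1,…,n} \ G_γ`:  `x^γ ∉ I S_{F ∪ G_γ}` iff `x^{γ'} ∉ I S_{(F ∩ T) ∪ G_{γ'}}`. -/
theorem statement6 {n : ℕ} (I : Ideal (MvPolynomial (Fin n) k)) (T : Finset (Fin n))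
    (hIT : ∃ G : Set (Fin n →₀ ℕ), (∀ d ∈ G, ∀ i, d i ≠ 0 → i ∈ T) ∧
      I = Ideal.span ((fun d => (monomial d (1 : k) : MvPolynomial (Fin n) k)) '' G))
    (γ : Fin n → ℤ) (F : Set (Fin n)) (hF : F ⊆ (negSupp γ)ᶜ) :
    xpow k (F ∪ negSupp γ) γ ∉ locIdeal k I (F ∪ negSupp γ) ↔
      xpow k ((F ∩ ↑T) ∪ negSupp (fun i => if i ∈ T then γ i else 0))
          (fun i => if i ∈ T then γ i else 0) ∉
        locIdeal k I ((F ∩ ↑T) ∪ negSupp (fun i => if i ∈ T then γ i else 0)) := by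
  obtain ⟨G, hG, rfl⟩ := hIT
  rw [xpow_mem_locIdeal_span_iff k G _ _ Set.subset_union_right,
    xpow_mem_locIdeal_span_iff k G _ _ Set.subset_union_right, not_iff_not]
  refine exists_congr fun d => and_congr_right fun hd => forall_congr' fun i => ?_
  by_cases hi : i ∈ T
  · simp [negSupp, hi]
  · have hdi : d i = 0 := by
      by_contra h
      exact hi (hG d hd i h)
    simp [negSupp, hi, hdi]
end
end

section
/- Let I, J ⊆ S be monomial ideals and γ ∈ ℤ^n. Then Δ_γ(I ∩ J) = Δ_γ(I) ∪ Δ_γ(J); that is, for every F ⊆ {1,…,n}∖G_γ, x^γ ∉ (I ∩ J) S_{F ∪ G_γ} if and only if x^γ ∉ I S_{F ∪ G_γ} or x^γ ∉ J S_{F ∪ G_γ}. -/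
open MvPolynomial

noncomputable section

variable (k : Type*) [Field k]

/-- for monomial ideals `I, J ⊆ S` and `γ ∈ ℤ^n`,
`Δ_γ(I ∩ J) = Δ_γ(I) ∪ Δ_γ(J)`; that is, for every `F ⊆ {1,…,n} \ G_γ`,
`x^γ ∉ (I ∩ J) S_{F∪G_γ}` iff `x^γ ∉ I S_{F∪G_γ}` or `x^γ ∉ J S_{F∪G_γ}`. -/
theorem statement8 {n : ℕ} (I J : Ideal (MvPolynomial (Fin n) k))
    (hI : IsMonomialIdeal k I) (hJ : IsMonomialIdeal k J) (γ : Fin n → ℤ) :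
    degCx k (I ⊓ J) γ = degCx k I γ ∪ degCx k J γ ∧
      ∀ F : Set (Fin n), F ⊆ (negSupp γ)ᶜ →
        (xpow k (F ∪ negSupp γ) γ ∉ locIdeal k (I ⊓ J) (F ∪ negSupp γ) ↔
          xpow k (F ∪ negSupp γ) γ ∉ locIdeal k I (F ∪ negSupp γ) ∨
            xpow k (F ∪ negSupp γ) γ ∉ locIdeal k J (F ∪ negSupp γ)) := by
  have key (F : Set (Fin n)) : xpow k F γ ∉ locIdeal k (I ⊓ J) F ↔
      xpow k F γ ∉ locIdeal k I F ∨ xpow k F γ ∉ locIdeal k J F := by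
    rw [locIdeal, IsLocalization.map_inf (varSubmonoid k (Fin n) F), Ideal.mem_inf, not_and_or]
    rfl
  refine ⟨?_, fun F _ => key _⟩
  ext F
  simp only [degCx, Set.mem_ofPred_eq, Set.mem_union, key, and_or_left]
end
end

section
/- Let I ⊆ A and J ⊆ B be monomial ideals, s ≥ 1, γ = (α,β) ∈ ℤ^σ × ℤ^τ, and F a subset of (σ ⊔ τ)∖G_γ. If F ∪ G_γ contains both an element of σ and an element of τ, then x^γ ∈ (I + J + mn)^s S_{F ∪ G_γ}; consequently F ∉ Δ_γ((I + J + mn)^s). -/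
open MvPolynomial

noncomputable section

variable (k : Type*) [Field k]

/-- Extension of an ideal of `A = k[x_i : i ∈ σ]` to `S = k[x_i : i ∈ σ ⊕ τ]` along the
renaming of variables by `Sum.inl`. -/
def extL {σ τ : Type*} (I : Ideal (MvPolynomial σ k)) : Ideal (MvPolynomial (σ ⊕ τ) k) :=
  Ideal.map (rename (Sum.inl : σ → σ ⊕ τ) :
    MvPolynomial σ k →ₐ[k] MvPolynomial (σ ⊕ τ) k).toRingHom I

/-- Extension of an ideal of `B = k[x_i : i ∈ τ]` to `S = k[x_i : i ∈ σ ⊕ τ]` along the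
renaming of variables by `Sum.inr`. -/
def extR {σ τ : Type*} (J : Ideal (MvPolynomial τ k)) : Ideal (MvPolynomial (σ ⊕ τ) k) :=
  Ideal.map (rename (Sum.inr : τ → σ ⊕ τ) :
    MvPolynomial τ k →ₐ[k] MvPolynomial (σ ⊕ τ) k).toRingHom J

/-- The maximal homogeneous ideal, generated by all the variables. -/
def maxIdeal (σ : Type*) : Ideal (MvPolynomial σ k) :=
  Ideal.span (Set.range (X : σ → MvPolynomial σ k))

/-- The fiber product `I + J + 𝔪𝔫` of `I ⊆ A` and `J ⊆ B`, an ideal of `S`, where `𝔪`, `𝔫`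
are the maximal homogeneous ideals of `A` and `B` (all extended to `S`). -/
def fibProd {σ τ : Type*} (I : Ideal (MvPolynomial σ k)) (J : Ideal (MvPolynomial τ k)) :
    Ideal (MvPolynomial (σ ⊕ τ) k) :=
  extL k I + extR k J + extL k (maxIdeal k σ) * extR k (maxIdeal k τ)

/-- A squarefree monomial ideal is an ideal generated by squarefree monomials. -/
def IsSqfMonomialIdeal {σ : Type*} (I : Ideal (MvPolynomial σ k)) : Prop :=
  ∃ G : Set (σ →₀ ℕ), (∀ d ∈ G, ∀ i, d i ≤ 1) ∧
    I = Ideal.span ((fun d => (monomial d (1 : k) : MvPolynomial σ k)) '' G)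

/-- Variables indexed by `F` become units in `S_F`. -/
lemma isUnit_algebraMap_X {σ : Type*} {F : Set σ} {i : σ} (hi : i ∈ F) :
    IsUnit (algebraMap (MvPolynomial σ k) (Loc k σ F) (X i)) :=
  IsLocalization.map_units (Loc k σ F)
    (⟨X i, Submonoid.subset_closure ⟨i, hi, rfl⟩⟩ : varSubmonoid k σ F)

/-- The product of a variable of `A` and a variable of `B` lies in the fiber product. -/
lemma X_mul_X_mem_fibProd {σ τ : Type*} (I : Ideal (MvPolynomial σ k))
    (J : Ideal (MvPolynomial τ k)) (i : σ) (j : τ) :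
    (X (Sum.inl i) * X (Sum.inr j) : MvPolynomial (σ ⊕ τ) k) ∈ fibProd k I J := by
  refine Ideal.mem_sup_right (Ideal.mul_mem_mul ?_ ?_)
  · simpa [extL] using Ideal.mem_map_of_mem (rename (Sum.inl : σ → σ ⊕ τ) :
      MvPolynomial σ k →ₐ[k] MvPolynomial (σ ⊕ τ) k).toRingHom
      (show X i ∈ maxIdeal k σ from Ideal.subset_span ⟨i, rfl⟩)
  · simpa [extR] using Ideal.mem_map_of_mem (rename (Sum.inr : τ → σ ⊕ τ) :
      MvPolynomial τ k →ₐ[k] MvPolynomial (σ ⊕ τ) k).toRingHom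
      (show X j ∈ maxIdeal k τ from Ideal.subset_span ⟨j, rfl⟩)

/-- Powers of the fiber product extend to the unit ideal of `S_F` as soon as `F` contains
a variable of `A` and a variable of `B`. -/
lemma locIdeal_fibProd_pow_eq_top {σ τ : Type*} (I : Ideal (MvPolynomial σ k))
    (J : Ideal (MvPolynomial τ k)) (s : ℕ) {F : Set (σ ⊕ τ)} {i : σ} {j : τ}
    (hi : Sum.inl i ∈ F) (hj : Sum.inr j ∈ F) :
    locIdeal k ((fibProd k I J) ^ s) F = ⊤ := by
  refine Ideal.eq_top_of_isUnit_mem _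
    (Ideal.mem_map_of_mem _ (Ideal.pow_mem_pow (X_mul_X_mem_fibProd k I J i j) s)) ?_
  rw [map_pow, map_mul]
  exact ((isUnit_algebraMap_X k hi).mul (isUnit_algebraMap_X k hj)).pow s

/-- for monomial ideals `I ⊆ A`, `J ⊆ B`, `s ≥ 1`, `γ = (α, β)`, and
`F ⊆ (σ ⊔ τ) \ G_γ` such that `F ∪ G_γ` meets both `σ` and `τ`, one has
`x^γ ∈ (I + J + 𝔪𝔫)^s S_{F ∪ G_γ}`; consequently `F ∉ Δ_γ((I + J + 𝔪𝔫)^s)`. -/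
theorem statement13 {σ τ : Type*} [Fintype σ] [Fintype τ]
    (I : Ideal (MvPolynomial σ k)) (J : Ideal (MvPolynomial τ k))
    (hI : IsMonomialIdeal k I) (hJ : IsMonomialIdeal k J)
    (s : ℕ) (hs : 1 ≤ s) (α : σ → ℤ) (β : τ → ℤ) (F : Set (σ ⊕ τ))
    (hF : F ⊆ (negSupp (Sum.elim α β))ᶜ)
    (h₁ : ∃ i : σ, Sum.inl i ∈ F ∪ negSupp (Sum.elim α β))
    (h₂ : ∃ j : τ, Sum.inr j ∈ F ∪ negSupp (Sum.elim α β)) :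
    xpow k (F ∪ negSupp (Sum.elim α β)) (Sum.elim α β) ∈
        locIdeal k ((fibProd k I J) ^ s) (F ∪ negSupp (Sum.elim α β)) ∧
      F ∉ degCx k ((fibProd k I J) ^ s) (Sum.elim α β) := by
  obtain ⟨i, hi⟩ := h₁
  obtain ⟨j, hj⟩ := h₂
  have h := locIdeal_fibProd_pow_eq_top k I J s hi hj
  have hmem : xpow k (F ∪ negSupp (Sum.elim α β)) (Sum.elim α β) ∈
      locIdeal k ((fibProd k I J) ^ s) (F ∪ negSupp (Sum.elim α β)) := h ▸ Submodule.mem_top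
  exact ⟨hmem, fun hF' => hF'.2 hmem⟩
end
end
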